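/- Let x be the horizontal component of the Peano curve. Let p' and q' be positive integers not divisible by 3, p = p'/q', θ ∈ [0,1), n ∈ ℤ, and let k be a positive integer such that p/3^{n-k+1} ≤ 1/3. Assume that for all m = 1,…,k and all j_1,…,j_{m-1} ∈ {0,1,2}, j_m ∈ {1,2}, the number θ - Σ_{l=1}^m j_l·3^n q'/(3^l p') is not an integer (this holds in particular when θ is irrational). Then Σ_{m=1}^k 3^{-(m-1)} Σ_{j_1,…,j_{m-1} ∈ {0,1,2}, j_m ∈ {1,2}} 1_{(0,1)}({θ - Σ_{l=1}^m j_l·3^n q'/(3^l p')})·(3^{m-1} p'/(3^n q'))² = (1/4)·(9^k - 1)/9^n·(p'/q')², and consequently [x]_1^{p/3^n, θp/3^n} = 3^{-k} Σ_{i_1,…,i_k ∈ {0,1,2}} [x]_1^{(3^k p')/(3^n q'), {θ - Σ_{v=1}^k i_v·3^n q'/(3^v p')}·(3^k p')/(3^n q')} + (1/4)·(9^k - 1)/9^n·(p'/q')². -/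

import Mathlib

open scoped BigOperators Classical
open Filter

noncomputable section

/-- The digit map `k n = 2 - n` on `{0,1,2}` (with truncated natural subtraction). -/
def peanoK : ℕ → ℕ := fun n => 2 - n

/-- The `m`-th (0-indexed) ternary digit of the horizontal component of the Peano curve
evaluated at the point with ternary digits `d` (0-indexed, i.e. `t_j = d (j-1)`):
the `j`-th digit of `x(t)` is `k^[t_2 + t_4 + ⋯ + t_{2j-2}] (t_{2j-1})`. -/
def peanoXDigit (d : ℕ → Fin 3) (m : ℕ) : ℕ :=
  peanoK^[∑ i ∈ Finset.range m, (d (2 * i + 1) : ℕ)] (d (2 * m) : ℕ)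

/-- `x : ℝ → ℝ` is (on `[0,1]`) the horizontal component of the Peano curve:
for every ternary expansion `t = Σ_j d_j 3^{-(j+1)}`, `x t` is given by the digit formula. -/
def IsPeanoX (x : ℝ → ℝ) : Prop :=
  ∀ d : ℕ → Fin 3,
    x (∑' j : ℕ, (d j : ℝ) / 3 ^ (j + 1)) = ∑' m : ℕ, (peanoXDigit d m : ℝ) / 3 ^ (m + 1)

/-- The grid `cℤ + r = {cq + r : q ∈ ℤ}`. -/
def peanoGrid (c r : ℝ) : Set ℝ := {u : ℝ | ∃ q : ℤ, u = c * q + r}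

/-- `lebTime x c r m` is the time `t_{m+1}(c,r)` of the Lebesgue partition `π(c,r)` for `x`
on `[0,1]` (values in `[0,1] ∪ {+∞}`, modelled in `EReal`; `sInf ∅ = ⊤ = +∞`). -/
def lebTime (x : ℝ → ℝ) (c r : ℝ) : ℕ → EReal
  | 0 => sInf (Real.toEReal '' {t : ℝ | t ∈ Set.Icc (0 : ℝ) 1 ∧ x t ∈ peanoGrid c r})
  | m + 1 =>
    if lebTime x c r m = ⊤ then ⊤
    else
      sInf (Real.toEReal ''
        {t : ℝ | t ∈ Set.Icc ((lebTime x c r m).toReal) 1 ∧ x t ∈ peanoGrid c r ∧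
          x t ≠ x ((lebTime x c r m).toReal)})

/-- `k(c,r,t) = min{m ∈ ℕ₊ : t_m(c,r) ≥ t}` (recall `t_m(c,r) = lebTime x c r (m-1)`). -/
def kIdx (x : ℝ → ℝ) (c r t : ℝ) : ℕ :=
  sInf {m : ℕ | 1 ≤ m ∧ (t : EReal) ≤ lebTime x c r (m - 1)}

/-- `l(c,r,t) = max{m ∈ ℕ₊ : t_m(c,r) ≤ t}`. -/
def lIdx (x : ℝ → ℝ) (c r t : ℝ) : ℕ :=
  sSup {m : ℕ | 1 ≤ m ∧ lebTime x c r (m - 1) ≤ (t : EReal)}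

/-- The quadratic variation `[x]_{s,t}^{c,r}` of `x` on `[s,t]` along the Lebesgue partition
`π(c,r)`: the sum over `m = k(c,r,s), …, l(c,r,t) - 1` of `(x(t_{m+1}) - x(t_m))²`. -/
def qvar (x : ℝ → ℝ) (c r s t : ℝ) : ℝ :=
  ∑ m ∈ Finset.Ico (kIdx x c r s) (lIdx x c r t),
    (x ((lebTime x c r m).toReal) - x ((lebTime x c r (m - 1)).toReal)) ^ 2

/-- `[x]_t^{c,r} := [x]_{0,t}^{c,r}`. -/
def qvar0 (x : ℝ → ℝ) (c r t : ℝ) : ℝ := qvar x c r 0 t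

/-- The digit sequence of `x(t)` as a sequence in `Fin 3`, in terms of the digits of `t`. -/
def peanoDigits (d : ℕ → Fin 3) (m : ℕ) : Fin 3 :=
  Fin.rev^[∑ i ∈ Finset.range m, (d (2 * i + 1) : ℕ)] (d (2 * m))

lemma peanoK_iterate_val (v : ℕ) (a : Fin 3) : peanoK^[v] (a : ℕ) = (Fin.rev^[v] a : Fin 3) := by
  induction v generalizing a with
  | zero => rfl
  | succ v ih =>
    have h : peanoK (a : ℕ) = (Fin.rev a : Fin 3) := by
      simp only [peanoK, Fin.val_rev]
      omega
    rw [Function.iterate_succ_apply, Function.iterate_succ_apply, h, ih]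

lemma IsPeanoX.apply_ofDigits {x : ℝ → ℝ} (hx : IsPeanoX x) (d : ℕ → Fin 3) :
    x (Real.ofDigits d) = Real.ofDigits (peanoDigits d) := by
  have h := hx d
  simpa [Real.ofDigits, Real.ofDigitsTerm, div_eq_mul_inv, peanoXDigit, peanoDigits,
    peanoK_iterate_val] using h

lemma exists_ofDigits_eq {t : ℝ} (ht : t ∈ Set.Icc (0 : ℝ) 1) :
    ∃ d : ℕ → Fin 3, Real.ofDigits d = t := by
  obtain ⟨d, -, hd⟩ := Real.ofDigits_SurjOn (b := 3) (by norm_num) ht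
  exact ⟨d, hd⟩

lemma ofDigits_mem_Icc (d : ℕ → Fin 3) : Real.ofDigits d ∈ Set.Icc (0 : ℝ) 1 :=
  ⟨Real.ofDigits_nonneg d, Real.ofDigits_le_one d⟩

lemma ofDigits_rev (d : ℕ → Fin 3) :
    Real.ofDigits (fun i => Fin.rev (d i)) = 1 - Real.ofDigits d := by
  rw [eq_sub_iff_add_eq, ← Real.ofDigits_const_last_eq_one' (b := 3) (by norm_num)]
  simp only [Real.ofDigits]
  rw [← Real.summable_ofDigitsTerm.tsum_add Real.summable_ofDigitsTerm]
  refine tsum_congr fun i => ?_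
  simp only [Real.ofDigitsTerm]
  rw [← add_mul, ← Nat.cast_add]
  congr 2
  simp only [Fin.val_rev]
  omega

lemma ofDigits_eq_head_add_tail (d : ℕ → Fin 3) :
    Real.ofDigits d = ((d 0 : ℕ) + Real.ofDigits fun i => d (i + 1)) / 3 := by
  have h := Real.ofDigits_eq_sum_add_ofDigits d 1
  simp only [Finset.sum_range_one, Real.ofDigitsTerm] at h
  rw [h]
  simp
  ring

lemma continuous_peanoDigits : Continuous peanoDigits := by
  refine continuous_pi fun m => ?_
  have h : Continuous fun p : ℕ × Fin 3 => Fin.rev^[p.1] p.2 := continuous_of_discreteTopology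
  have hv : Continuous fun a : Fin 3 => (a : ℕ) := continuous_of_discreteTopology
  have hs : Continuous fun d : ℕ → Fin 3 => ∑ i ∈ Finset.range m, (d (2 * i + 1) : ℕ) :=
    continuous_finsetSum _ fun i _ => hv.comp (continuous_apply (2 * i + 1))
  exact h.comp (hs.prodMk (continuous_apply (2 * m)))

lemma rev_iterate_comm (v : ℕ) (a : Fin 3) : Fin.rev^[v] (Fin.rev a) = Fin.rev (Fin.rev^[v] a) :=
  (Function.Commute.refl Fin.rev).iterate_left v a

lemma peanoDigits_rev (d : ℕ → Fin 3) :
    peanoDigits (fun i => Fin.rev (d i)) = fun m => Fin.rev (peanoDigits d m) := by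
  have hinv : Function.Involutive (Fin.rev : Fin 3 → Fin 3) := Fin.rev_involutive
  funext m
  simp only [peanoDigits]
  rw [rev_iterate_comm]
  congr 1
  have key : ∀ v w : ℕ, v % 2 = w % 2 → (Fin.rev : Fin 3 → Fin 3)^[v] = Fin.rev^[w] := by
    intro v w hvw
    rcases Nat.even_or_odd v with hv | hv
    · rw [hinv.iterate_even hv, hinv.iterate_even (by grind)]
    · rw [hinv.iterate_odd hv, hinv.iterate_odd (by grind)]
  rw [key]
  induction m with
  | zero => rfl
  | succ m ih =>
    rw [Finset.sum_range_succ, Finset.sum_range_succ, Nat.add_mod, ih, ← Nat.add_mod]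
    simp only [Fin.val_rev]
    omega

namespace IsPeanoX

variable {x : ℝ → ℝ}

lemma mem_Icc (hx : IsPeanoX x) {t : ℝ} (ht : t ∈ Set.Icc (0 : ℝ) 1) : x t ∈ Set.Icc (0 : ℝ) 1 := by
  obtain ⟨d, rfl⟩ := exists_ofDigits_eq ht
  rw [hx.apply_ofDigits]
  exact ofDigits_mem_Icc _

lemma one_sub (hx : IsPeanoX x) {t : ℝ} (ht : t ∈ Set.Icc (0 : ℝ) 1) : x (1 - t) = 1 - x t := by
  obtain ⟨d, rfl⟩ := exists_ofDigits_eq ht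
  rw [← ofDigits_rev, hx.apply_ofDigits, peanoDigits_rev, ofDigits_rev, hx.apply_ofDigits]

lemma continuousOn (hx : IsPeanoX x) : ContinuousOn x (Set.Icc 0 1) := by
  rw [continuousOn_iff_continuous_domRestrict]
  let φ : (ℕ → Fin 3) → Set.Icc (0 : ℝ) 1 := fun d => ⟨Real.ofDigits d, ofDigits_mem_Icc d⟩
  have hφ : Continuous φ := Real.continuous_ofDigits.subtype_mk _
  have hsurj : Function.Surjective φ := fun t => by
    obtain ⟨d, hd⟩ := exists_ofDigits_eq t.2
    exact ⟨d, Subtype.ext hd⟩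
  have hq : Topology.IsQuotientMap φ := hφ.isClosedMap.isQuotientMap hφ hsurj
  rw [hq.continuous_iff]
  have : (Set.Icc (0 : ℝ) 1).domRestrict x ∘ φ = fun d => Real.ofDigits (peanoDigits d) := by
    funext d
    exact hx.apply_ofDigits d
  rw [this]
  exact Real.continuous_ofDigits.comp continuous_peanoDigits

/-- The self-similarity of the horizontal component of the Peano curve. -/
lemma self_similar (hx : IsPeanoX x) (a b : Fin 3) {s : ℝ} (hs : s ∈ Set.Icc (0 : ℝ) 1) :
    x ((3 * (a : ℕ) + (b : ℕ) + s) / 9) = ((a : ℕ) + if b = 1 then 1 - x s else x s) / 3 := by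
  have hinv : Function.Involutive (Fin.rev : Fin 3 → Fin 3) := Fin.rev_involutive
  obtain ⟨d, rfl⟩ := exists_ofDigits_eq hs
  let e : ℕ → Fin 3 := fun i => match i with
    | 0 => a
    | 1 => b
    | j + 2 => d j
  have he : Real.ofDigits e = (3 * (a : ℕ) + (b : ℕ) + Real.ofDigits d) / 9 := by
    rw [ofDigits_eq_head_add_tail, ofDigits_eq_head_add_tail fun i => e (i + 1)]
    simp only [e]
    ring
  have hpe : (fun i => peanoDigits e (i + 1)) = fun i => Fin.rev^[(b : ℕ)] (peanoDigits d i) := by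
    funext i
    simp only [peanoDigits]
    rw [Finset.sum_range_succ', ← Function.iterate_add_apply, add_comm]
    rfl
  rw [← he, hx.apply_ofDigits, ofDigits_eq_head_add_tail, hpe, hx.apply_ofDigits]
  congr 2
  fin_cases b
  · simp
  · simpa using ofDigits_rev _
  · simp

lemma map_zero (hx : IsPeanoX x) : x 0 = 0 := by
  have h := hx.self_similar 0 0 (s := 0) (by simp)
  norm_num at h
  linarith

lemma map_one (hx : IsPeanoX x) : x 1 = 1 := by
  have h := hx.one_sub (t := 0) (by simp)
  simpa [hx.map_zero] using h

end IsPeanoX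

/-- `Visits f G s e w`: the interval `[s, e]` can be cut into finitely many consecutive pieces, on
each of which `f` takes at most one value in `G`, and `w` lists these values in order. -/
inductive Visits (f : ℝ → ℝ) (G : Set ℝ) : ℝ → ℝ → List ℝ → Prop
  | empty {s e : ℝ} (hse : s ≤ e) (h : ∀ t ∈ Set.Icc s e, f t ∉ G) : Visits f G s e []
  | single {s e a b : ℝ} (g : ℝ) (ha : IsLeast {t | t ∈ Set.Icc s e ∧ f t ∈ G} a)
      (hb : IsGreatest {t | t ∈ Set.Icc s e ∧ f t ∈ G} b)
      (h : ∀ t ∈ Set.Icc s e, f t ∈ G → f t = g) : Visits f G s e [g]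
  | append {s u e : ℝ} {w₁ w₂ : List ℝ} (h₁ : Visits f G s u w₁) (h₂ : Visits f G u e w₂) :
      Visits f G s e (w₁ ++ w₂)

namespace Visits

variable {f : ℝ → ℝ} {G : Set ℝ} {s e : ℝ} {w : List ℝ}

lemma le (h : Visits f G s e w) : s ≤ e := by
  induction h with
  | empty hse _ => exact hse
  | single g ha _ _ => exact ha.1.1.1.trans ha.1.1.2
  | append _ _ h₁ h₂ => exact h₁.trans h₂

lemma comp_neg (h : Visits f G s e w) : Visits (fun t => f (-t)) G (-e) (-s) w.reverse := by
  induction h with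
  | empty hse h =>
    exact empty (neg_le_neg hse) fun t ht => h (-t) ⟨by linarith [ht.2], by linarith [ht.1]⟩
  | @single s e a b g ha hb h =>
    refine single (a := -b) (b := -a) g ⟨?_, ?_⟩ ⟨?_, ?_⟩ ?_
    · exact ⟨⟨by linarith [hb.1.1.2], by linarith [hb.1.1.1]⟩, by simpa using hb.1.2⟩
    · rintro t ⟨ht, htG⟩
      linarith [hb.2 (show -t ∈ _ from ⟨⟨by linarith [ht.2], by linarith [ht.1]⟩, htG⟩)]
    · exact ⟨⟨by linarith [ha.1.1.2], by linarith [ha.1.1.1]⟩, by simpa using ha.1.2⟩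
    · rintro t ⟨ht, htG⟩
      linarith [ha.2 (show -t ∈ _ from ⟨⟨by linarith [ht.2], by linarith [ht.1]⟩, htG⟩)]
    · exact fun t ht => h (-t) ⟨by linarith [ht.2], by linarith [ht.1]⟩
  | append _ _ h₁ h₂ =>
    rw [List.reverse_append]
    exact append h₂ h₁

/-- Increasing affine changes of time, combined with a change of the values and of the grid. -/
lemma comp_affine {f' h : ℝ → ℝ} {G' : Set ℝ} {α : ℝ} (β : ℝ) (hα : 0 < α)
    (hG : ∀ v, h v ∈ G' ↔ v ∈ G) (hw : Visits f G s e w)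
    (hf : ∀ t ∈ Set.Icc s e, f' (α * t + β) = h (f t)) :
    Visits f' G' (α * s + β) (α * e + β) (w.map h) := by
  have inv : ∀ {s e : ℝ}, ∀ t ∈ Set.Icc (α * s + β) (α * e + β),
      ∃ t' ∈ Set.Icc s e, t = α * t' + β := fun t ht =>
    ⟨(t - β) / α, ⟨by rw [le_div_iff₀ hα]; linarith [ht.1], by rw [div_le_iff₀ hα]; linarith [ht.2]⟩,
      by field_simp; ring⟩
  have mono : ∀ {a b : ℝ}, a ≤ b → α * a + β ≤ α * b + β := fun hab => by
    linarith [mul_le_mul_of_nonneg_left hab hα.le]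
  induction hw with
  | empty hse h =>
    refine empty (mono hse) fun t ht => ?_
    obtain ⟨t', ht', rfl⟩ := inv t ht
    rw [hf t' ht', hG]
    exact h t' ht'
  | @single s e a b g ha hb hg =>
    refine single (a := α * a + β) (b := α * b + β) (h g) ⟨?_, ?_⟩ ⟨?_, ?_⟩ ?_
    · exact ⟨⟨mono ha.1.1.1, mono ha.1.1.2⟩, by rw [hf a ha.1.1, hG]; exact ha.1.2⟩
    · rintro t ⟨ht, htG⟩
      obtain ⟨t', ht', rfl⟩ := inv t ht
      rw [hf t' ht', hG] at htG
      exact mono (ha.2 ⟨ht', htG⟩)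
    · exact ⟨⟨mono hb.1.1.1, mono hb.1.1.2⟩, by rw [hf b hb.1.1, hG]; exact hb.1.2⟩
    · rintro t ⟨ht, htG⟩
      obtain ⟨t', ht', rfl⟩ := inv t ht
      rw [hf t' ht', hG] at htG
      exact mono (hb.2 ⟨ht', htG⟩)
    · intro t ht htG
      obtain ⟨t', ht', rfl⟩ := inv t ht
      rw [hf t' ht', hG] at htG
      rw [hf t' ht', hg t' ht' htG]
  | append h₁ h₂ ih₁ ih₂ =>
    rw [List.map_append]
    exact append (ih₁ fun t ht => hf t ⟨ht.1, ht.2.trans h₂.le⟩)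
      (ih₂ fun t ht => hf t ⟨h₁.le.trans ht.1, ht.2⟩)

lemma notMem_of_nil (h : Visits f G s e w) (hw : w = []) : ∀ t ∈ Set.Icc s e, f t ∉ G := by
  induction h with
  | empty _ h => exact h
  | single => simp at hw
  | @append s u e w₁ w₂ h₁ h₂ ih₁ ih₂ =>
    obtain ⟨h₁, h₂⟩ := List.append_eq_nil_iff.1 hw
    intro t ht
    rcases le_total t u with htu | htu
    · exact ih₁ h₁ t ⟨ht.1, htu⟩
    · exact ih₂ h₂ t ⟨htu, ht.2⟩

/-- The head of the list of visited values is the value visited first. -/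
lemma exists_first {g : ℝ} {l : List ℝ} (h : Visits f G s e w) (hw : w = g :: l) :
    ∃ τ ∈ Set.Icc s e, f τ = g ∧ g ∈ G ∧ ∀ t ∈ Set.Icc s τ, f t ∈ G → f t = g := by
  induction h generalizing l with
  | empty => simp at hw
  | @single s e a b g' ha hb h =>
    obtain ⟨rfl, -⟩ := List.cons_eq_cons.1 hw
    have hag := h a ha.1.1 ha.1.2
    exact ⟨a, ha.1.1, hag, hag ▸ ha.1.2, fun t ht => h t ⟨ht.1, ht.2.trans ha.1.1.2⟩⟩
  | @append s u e w₁ w₂ h₁ h₂ ih₁ ih₂ =>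
    cases w₁ with
    | nil =>
      obtain ⟨τ, hτ, hτg, hg, hfirst⟩ := ih₂ hw
      refine ⟨τ, ⟨h₁.le.trans hτ.1, hτ.2⟩, hτg, hg, fun t ht htG => ?_⟩
      rcases le_total t u with htu | htu
      · exact absurd htG (h₁.notMem_of_nil rfl t ⟨ht.1, htu⟩)
      · exact hfirst t ⟨htu, ht.2⟩ htG
    | cons g' l' =>
      obtain ⟨rfl, -⟩ := List.cons_eq_cons.1 hw
      obtain ⟨τ, hτ, h⟩ := ih₁ rfl
      exact ⟨τ, ⟨hτ.1, hτ.2.trans h₂.le⟩, h⟩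

end Visits

lemma peanoGrid_eq_preimage {c : ℝ} (hc : c ≠ 0) (r : ℝ) :
    peanoGrid c r = (fun u => (u - r) / c) ⁻¹' Set.range ((↑) : ℤ → ℝ) := by
  ext u
  simp only [peanoGrid, Set.mem_ofPred_eq, Set.mem_preimage, Set.mem_range]
  refine exists_congr fun q => ?_
  rw [eq_div_iff hc]
  constructor <;> intro h <;> linarith

lemma isClosed_peanoGrid {c : ℝ} (hc : c ≠ 0) (r : ℝ) : IsClosed (peanoGrid c r) := by
  rw [peanoGrid_eq_preimage hc]
  exact Int.isClosedEmbedding_coe_real.isClosed_range.preimage (by fun_prop)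

lemma eq_of_mem_peanoGrid_of_abs_sub_lt {c r u v : ℝ} (hu : u ∈ peanoGrid c r)
    (hv : v ∈ peanoGrid c r) (h : |u - v| < c) : u = v := by
  obtain ⟨p, rfl⟩ := hu
  obtain ⟨q, rfl⟩ := hv
  have hc : 0 < c := (abs_nonneg _).trans_lt h
  have h1 : c * |(p : ℝ) - q| < c * 1 := by
    rw [mul_one, ← abs_of_pos hc, ← abs_mul, abs_of_pos hc]
    rwa [show c * ((p : ℝ) - q) = c * p + r - (c * q + r) by ring]
  have h2 : |p - q| < 1 := by exact_mod_cast lt_of_mul_lt_mul_left h1 hc.le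
  rw [Int.abs_lt_one_iff, sub_eq_zero] at h2
  rw [h2]

lemma Visits.exists_of_continuousOn {f : ℝ → ℝ} (hf : ContinuousOn f (Set.Icc 0 1)) {c : ℝ}
    (hc : 0 < c) (r : ℝ) : ∃ w, Visits f (peanoGrid c r) 0 1 w := by
  have local_word : ∀ s e : ℝ, s ≤ e → Set.Icc s e ⊆ Set.Icc 0 1 →
      (∀ u ∈ Set.Icc s e, ∀ v ∈ Set.Icc s e, |f u - f v| < c) →
      ∃ w, Visits f (peanoGrid c r) s e w := by
    intro s e hse hsub hosc
    have hcomp : IsCompact {t | t ∈ Set.Icc s e ∧ f t ∈ peanoGrid c r} :=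
      isCompact_Icc.of_isClosed_subset
        ((hf.mono hsub).preimage_isClosed_of_isClosed isClosed_Icc (isClosed_peanoGrid hc.ne' r))
        fun t ht => ht.1
    rcases Set.eq_empty_or_nonempty {t | t ∈ Set.Icc s e ∧ f t ∈ peanoGrid c r} with h | h
    · exact ⟨[], .empty hse fun t ht htG => (Set.eq_empty_iff_forall_notMem.1 h t) ⟨ht, htG⟩⟩
    · obtain ⟨a, ha⟩ := hcomp.exists_isLeast h
      obtain ⟨b, hb⟩ := hcomp.exists_isGreatest h
      exact ⟨[f a], .single (f a) ha hb fun t ht htG =>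
        eq_of_mem_peanoGrid_of_abs_sub_lt htG ha.1.2 (hosc t ht a ha.1.1)⟩
  obtain ⟨δ, hδ, hunif⟩ := Metric.uniformContinuousOn_iff.1
    (isCompact_Icc.uniformContinuousOn_of_continuous hf) c hc
  obtain ⟨N, hN⟩ := exists_nat_one_div_lt hδ
  have hN0 : (0 : ℝ) < N + 1 := by positivity
  have key : ∀ i : ℕ, i ≤ N + 1 → ∃ w, Visits f (peanoGrid c r) 0 (i / (N + 1)) w := by
    intro i
    induction i with
    | zero =>
      intro _
      refine local_word _ _ (by simp) (by simp) ?_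
      intro u hu v hv
      have hu0 : u = 0 := by simpa using hu
      have hv0 : v = 0 := by simpa using hv
      simpa [hu0, hv0] using hc
    | succ i ih =>
      intro hi
      obtain ⟨w₁, h₁⟩ := ih (by omega)
      have hi' : ((i + 1 : ℕ) : ℝ) ≤ N + 1 := by exact_mod_cast hi
      have hlen : ((i + 1 : ℕ) : ℝ) / (N + 1) = i / (N + 1) + 1 / (N + 1) := by
        push_cast
        ring
      have hle1 : ((i + 1 : ℕ) : ℝ) / (N + 1) ≤ 1 := (div_le_one hN0).2 hi'
      have h0 : (0 : ℝ) ≤ i / (N + 1) := by positivity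
      have hpos : (0 : ℝ) < 1 / (N + 1) := by positivity
      have hsub : Set.Icc ((i : ℝ) / (N + 1)) (((i + 1 : ℕ) : ℝ) / (N + 1)) ⊆ Set.Icc 0 1 :=
        Set.Icc_subset_Icc h0 hle1
      obtain ⟨w₂, h₂⟩ := local_word (i / (N + 1)) ((i + 1 : ℕ) / (N + 1)) (by linarith) hsub <| by
        intro u hu v hv
        refine hunif u (hsub hu) v (hsub hv) ?_
        rw [Real.dist_eq, abs_lt]
        constructor <;> linarith [hu.1, hu.2, hv.1, hv.2]
      exact ⟨w₁ ++ w₂, h₁.append h₂⟩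
  obtain ⟨w, hw⟩ := key (N + 1) le_rfl
  refine ⟨w, ?_⟩
  rwa [show (((N + 1 : ℕ) : ℝ) / (N + 1)) = 1 by push_cast; exact div_self hN0.ne'] at hw

/-- `GreedyTimes f G e s o ts`: after time `s`, with current value `o`, the successive first times
in `[s, e]` at which `f` hits a value in `G` different from the current one are listed by `ts`. -/
def GreedyTimes (f : ℝ → ℝ) (G : Set ℝ) (e : ℝ) : ℝ → Option ℝ → List ℝ → Prop
  | s, o, [] => ∀ t ∈ Set.Icc s e, f t ∈ G → some (f t) = o
  | s, o, τ :: ts => IsLeast {t | t ∈ Set.Icc s e ∧ f t ∈ G ∧ some (f t) ≠ o} τ ∧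
      GreedyTimes f G e τ (some (f τ)) ts

/-- The sum of the squared increments along a list, preceded by an optional initial value. -/
def sqIncr : Option ℝ → List ℝ → ℝ
  | _, [] => 0
  | none, g :: l => sqIncr (some g) l
  | some h, g :: l => (g - h) ^ 2 + sqIncr (some g) l

lemma sqIncr_append (o : Option ℝ) (l₁ l₂ : List ℝ) :
    sqIncr o (l₁ ++ l₂) = sqIncr o l₁ + sqIncr (l₁.getLast?.or o) l₂ := by
  induction l₁ generalizing o with
  | nil => simp [sqIncr]
  | cons g l ih =>
    have hlast : (g :: l).getLast?.or o = l.getLast?.or (some g) := by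
      rw [List.getLast?_cons]
      cases l.getLast? <;> simp
    rw [hlast]
    cases o with
    | none => simp [sqIncr, ih]
    | some h => simp [sqIncr, ih, add_assoc]

lemma sqIncr_map_affine (a b : ℝ) (o : Option ℝ) (l : List ℝ) :
    sqIncr (o.map fun v => a * v + b) (l.map fun v => a * v + b) = a ^ 2 * sqIncr o l := by
  induction l generalizing o with
  | nil => simp [sqIncr]
  | cons g l ih =>
    have h := ih (some g)
    simp only [Option.map_some] at h
    cases o with
    | none => simpa [sqIncr] using h
    | some v =>
      simp only [sqIncr, Option.map_some, List.map_cons, h]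
      ring

lemma sqIncr_some (h : ℝ) (l : List ℝ) :
    sqIncr (some h) l = (l.head?.elim 0 fun g => (g - h) ^ 2) + sqIncr none l := by
  cases l <;> simp [sqIncr]

lemma sqIncr_none_reverse (l : List ℝ) : sqIncr none l.reverse = sqIncr none l := by
  induction l with
  | nil => rfl
  | cons g l ih =>
    rw [List.reverse_cons, sqIncr_append, ih]
    cases l with
    | nil => simp [sqIncr]
    | cons g' l =>
      simp [sqIncr]
      ring

namespace GreedyTimes

variable {f : ℝ → ℝ} {G : Set ℝ} {s u e : ℝ} {o : Option ℝ} {ts : List ℝ}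

lemma extend_left (hsu : s ≤ u) (h : ∀ t ∈ Set.Icc s u, f t ∈ G → some (f t) = o)
    (hts : GreedyTimes f G e u o ts) : GreedyTimes f G e s o ts := by
  cases ts with
  | nil =>
    intro t ht htG
    rcases le_total t u with htu | htu
    · exact h t ⟨ht.1, htu⟩ htG
    · exact hts t ⟨htu, ht.2⟩ htG
  | cons τ ts =>
    obtain ⟨⟨⟨hτ, hτG⟩, hmin⟩, hts⟩ := hts
    refine ⟨⟨⟨⟨hsu.trans hτ.1, hτ.2⟩, hτG⟩, ?_⟩, hts⟩
    rintro t ⟨ht, htG, hto⟩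
    rcases le_total t u with htu | htu
    · exact absurd (h t ⟨ht.1, htu⟩ htG) hto
    · exact hmin ⟨⟨htu, ht.2⟩, htG, hto⟩

lemma append {ts' : List ℝ} (hsu : s ≤ u) (hue : u ≤ e) (h : GreedyTimes f G u s o ts)
    (h' : GreedyTimes f G e u ((ts.map f).getLast?.or o) ts') :
    GreedyTimes f G e s o (ts ++ ts') := by
  induction ts generalizing s o with
  | nil => exact extend_left hsu h (by simpa using h')
  | cons τ ts ih =>
    obtain ⟨⟨⟨hτ, hτG⟩, hmin⟩, hts⟩ := h
    have hlast : ((τ :: ts).map f).getLast?.or o = (ts.map f).getLast?.or (some (f τ)) := by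
      rw [List.map_cons, List.getLast?_cons]
      cases (ts.map f).getLast? <;> simp
    refine ⟨⟨⟨⟨hτ.1, hτ.2.trans hue⟩, hτG⟩, ?_⟩, ih hτ.2 hts (hlast ▸ h')⟩
    rintro t ⟨ht, htG⟩
    rcases le_total t u with htu | htu
    · exact hmin ⟨⟨ht.1, htu⟩, htG⟩
    · exact hτ.2.trans htu

lemma mem_Icc (h : GreedyTimes f G e s o ts) : ∀ τ ∈ ts, τ ∈ Set.Icc s e := by
  induction ts generalizing s o with
  | nil => simp
  | cons τ ts ih =>
    intro σ hσ
    rcases List.mem_cons.1 hσ with rfl | hσ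
    · exact h.1.1.1
    · have := ih h.2 σ hσ
      exact ⟨h.1.1.1.1.trans this.1, this.2⟩

end GreedyTimes

/-- Repetitions in the list of visited values do not contribute to the quadratic variation along
the greedy times. -/
lemma Visits.exists_greedyTimes {f : ℝ → ℝ} {G : Set ℝ} {s e : ℝ} {w : List ℝ}
    (h : Visits f G s e w) (o : Option ℝ) :
    ∃ ts, GreedyTimes f G e s o ts ∧ sqIncr o (ts.map f) = sqIncr o w ∧
      (ts.map f).getLast?.or o = w.getLast?.or o := by
  induction h generalizing o with
  | empty _ h => exact ⟨[], fun t ht htG => absurd htG (h t ht), rfl, rfl⟩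
  | @single s e a b g ha hb h =>
    by_cases ho : o = some g
    · subst ho
      exact ⟨[], fun t ht htG => congrArg some (h t ht htG), by simp [sqIncr], by simp⟩
    · have hag : f a = g := h a ha.1.1 ha.1.2
      refine ⟨[a], ⟨⟨⟨ha.1.1, ha.1.2, ?_⟩, fun t ht => ha.2 ⟨ht.1, ht.2.1⟩⟩, ?_⟩, ?_, ?_⟩
      · rw [hag]
        exact fun h => ho h.symm
      · intro t ht htG
        rw [hag, h t ⟨ha.1.1.1.trans ht.1, ht.2⟩ htG]
      · simp [hag]
      · simp [hag]
  | append h₁ h₂ ih₁ ih₂ =>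
    obtain ⟨ts₁, hg₁, hs₁, hl₁⟩ := ih₁ o
    obtain ⟨ts₂, hg₂, hs₂, hl₂⟩ := ih₂ ((ts₁.map f).getLast?.or o)
    refine ⟨ts₁ ++ ts₂, hg₁.append h₁.le h₂.le hg₂, ?_, ?_⟩
    · rw [List.map_append, sqIncr_append, sqIncr_append, hs₁, hs₂, hl₁]
    · rw [List.map_append, List.getLast?_append, List.getLast?_append, Option.or_assoc,
        Option.or_assoc, hl₂, hl₁]

lemma sInf_image_toEReal_of_isLeast {A : Set ℝ} {τ : ℝ} (h : IsLeast A τ) :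
    sInf (Real.toEReal '' A) = (τ : EReal) :=
  ((EReal.coe_strictMono.monotone.map_isLeast h)).csInf_eq

lemma sInf_image_toEReal_of_forall_notMem {A : Set ℝ} (h : ∀ t, t ∉ A) :
    sInf (Real.toEReal '' A) = ⊤ := by
  rw [Set.eq_empty_iff_forall_notMem.2 h, Set.image_empty, sInf_empty]

lemma lebTime_eq_top_of_le {x : ℝ → ℝ} {c r : ℝ} {m m' : ℕ} (hm : m ≤ m')
    (h : lebTime x c r m = ⊤) : lebTime x c r m' = ⊤ := by
  induction m', hm using Nat.le_induction with
  | base => exact h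
  | succ m' _ ih => rw [lebTime, if_pos ih]

lemma GreedyTimes.lebTime_add {x : ℝ → ℝ} {c r τ : ℝ} {ts : List ℝ} {m : ℕ}
    (hτ : lebTime x c r m = (τ : EReal))
    (h : GreedyTimes x (peanoGrid c r) 1 τ (some (x τ)) ts) (i : ℕ) :
    lebTime x c r (m + 1 + i) = ts[i]?.elim ⊤ Real.toEReal := by
  have hstep : lebTime x c r (m + 1) = sInf (Real.toEReal '' {t : ℝ | t ∈ Set.Icc τ 1 ∧
      x t ∈ peanoGrid c r ∧ x t ≠ x τ}) := by
    rw [lebTime, if_neg (by rw [hτ]; exact EReal.coe_ne_top τ), hτ, EReal.toReal_coe]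
  induction ts generalizing m τ i with
  | nil =>
    refine lebTime_eq_top_of_le (Nat.le_add_right (m + 1) i) ?_
    rw [hstep]
    refine sInf_image_toEReal_of_forall_notMem ?_
    rintro t ⟨ht, htG, hne⟩
    exact hne (Option.some_injective _ (h t ht htG))
  | cons σ ts ih =>
    have hσ : lebTime x c r (m + 1) = (σ : EReal) := by
      rw [hstep]
      refine sInf_image_toEReal_of_isLeast ?_
      simpa only [ne_eq, Option.some.injEq] using h.1
    cases i with
    | zero => simpa using hσ
    | succ i =>
      have := ih hσ h.2 i (by
        rw [lebTime, if_neg (by rw [hσ]; exact EReal.coe_ne_top σ), hσ, EReal.toReal_coe])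
      rw [show m + 1 + (i + 1) = m + 1 + 1 + i by ring, this]
      simp

lemma GreedyTimes.lebTime_eq {x : ℝ → ℝ} {c r : ℝ} {ts : List ℝ}
    (h : GreedyTimes x (peanoGrid c r) 1 0 none ts) (i : ℕ) :
    lebTime x c r i = ts[i]?.elim ⊤ Real.toEReal := by
  cases ts with
  | nil =>
    refine lebTime_eq_top_of_le (Nat.zero_le i) ?_
    rw [lebTime]
    refine sInf_image_toEReal_of_forall_notMem ?_
    rintro t ⟨ht, htG⟩
    simpa using h t ht htG
  | cons σ ts =>
    have hσ : lebTime x c r 0 = (σ : EReal) := by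
      rw [lebTime]
      refine sInf_image_toEReal_of_isLeast ?_
      simpa using h.1
    cases i with
    | zero => simpa using hσ
    | succ i =>
      rw [show i + 1 = 0 + 1 + i by ring, GreedyTimes.lebTime_add hσ h.2]
      simp [show 0 + 1 + i = i + 1 by ring]

lemma sqIncr_none_map_eq_sum (f : ℝ → ℝ) (ts : List ℝ) :
    sqIncr none (ts.map f) =
      ∑ m ∈ Finset.Ico 1 ts.length, (f (ts.getD m 0) - f (ts.getD (m - 1) 0)) ^ 2 := by
  induction ts with
  | nil => simp [sqIncr]
  | cons a ts ih =>
    cases ts with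
    | nil => simp [sqIncr]
    | cons b ts =>
      rw [List.length_cons, Finset.sum_eq_sum_Ico_succ_bot (by simp)]
      simp only [List.map_cons, sqIncr] at ih ⊢
      rw [ih, ← Finset.sum_Ico_add' _ 1 _ 1]
      congr 1
      refine Finset.sum_congr rfl fun m hm => ?_
      obtain ⟨m, rfl⟩ := Nat.exists_eq_add_of_le' (Finset.mem_Ico.1 hm).1
      simp

/-- The quadratic variation along the Lebesgue partition is the sum of the squared increments of
any list of visited grid values. -/
lemma Visits.qvar0_eq {x : ℝ → ℝ} {c r : ℝ} {w : List ℝ} (h : Visits x (peanoGrid c r) 0 1 w) :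
    qvar0 x c r 1 = sqIncr none w := by
  obtain ⟨ts, hts, hs, -⟩ := h.exists_greedyTimes none
  have hleb := hts.lebTime_eq
  have hmem := hts.mem_Icc
  have hfin : ∀ m, lebTime x c r m ≤ ((1 : ℝ) : EReal) ↔ m < ts.length := by
    intro m
    rw [hleb]
    rcases lt_or_ge m ts.length with hm | hm
    · simp only [List.getElem?_eq_getElem hm, Option.elim_some, hm, iff_true]
      exact EReal.coe_le_coe_iff.2 (hmem _ (List.getElem_mem hm)).2
    · simp only [List.getElem?_eq_none hm, Option.elim_none, hm.not_gt, iff_false, top_le_iff]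
      exact EReal.coe_ne_top 1
  have hl : lIdx x c r 1 = ts.length := by
    have : {m : ℕ | 1 ≤ m ∧ lebTime x c r (m - 1) ≤ ((1 : ℝ) : EReal)} =
        Set.Icc 1 ts.length := by
      ext m
      simp only [Set.mem_ofPred_eq, Set.mem_Icc, hfin]
      omega
    rw [lIdx, this]
    rcases Nat.eq_zero_or_pos ts.length with h0 | h0
    · simp [h0]
    · exact csSup_Icc h0
  have hk : kIdx x c r 0 = 1 := by
    refine le_antisymm (Nat.sInf_le ⟨le_rfl, ?_⟩) (le_csInf ⟨1, le_rfl, ?_⟩ fun m hm => hm.1)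
    all_goals
      rw [hleb]
      rcases ts with _ | ⟨τ, ts⟩
      · simp
      · exact EReal.coe_le_coe_iff.2 (hmem τ (by simp)).1
  have hval : ∀ m < ts.length, (lebTime x c r m).toReal = ts.getD m 0 := by
    intro m hm
    rw [hleb, List.getElem?_eq_getElem hm, List.getD_eq_getElem _ _ hm]
    rfl
  rw [qvar0, qvar, hk, hl, ← hs, sqIncr_none_map_eq_sum]
  refine Finset.sum_congr rfl fun m hm => ?_
  rw [Finset.mem_Ico] at hm
  rw [hval m hm.2, hval (m - 1) (by omega)]

lemma sqIncr_append_of_head_last {l₁ l₂ : List ℝ} {h g : ℝ} (h₁ : l₁.getLast? = some h)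
    (h₂ : l₂.head? = some g) :
    sqIncr none (l₁ ++ l₂) = sqIncr none l₁ + (g - h) ^ 2 + sqIncr none l₂ := by
  rw [sqIncr_append, h₁, Option.some_or, sqIncr_some, h₂, Option.elim_some, add_assoc]

lemma exists_mem_peanoGrid_Ico {c : ℝ} (hc : 0 < c) (r : ℝ) :
    ∃ g ∈ peanoGrid c r, g ∈ Set.Ico 0 c := by
  refine ⟨c * Int.fract (r / c), ⟨-⌊r / c⌋, ?_⟩, ?_, ?_⟩
  · have : Int.fract (r / c) = r / c - ⌊r / c⌋ := rfl
    rw [this]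
    push_cast
    field_simp
    ring
  · exact mul_nonneg hc.le (Int.fract_nonneg _)
  · simpa using mul_lt_mul_of_pos_left (Int.fract_lt_one (r / c)) hc

lemma sub_mem_peanoGrid {c r g : ℝ} (hg : g ∈ peanoGrid c r) : g - c ∈ peanoGrid c r := by
  obtain ⟨q, rfl⟩ := hg
  exact ⟨q - 1, by push_cast; ring⟩

/-- A grid value just below `v` and one just above `v` are neighbours, if `v` is not in the
grid. -/
lemma sub_eq_of_notMem_peanoGrid {c r v g g' : ℝ} (hv : v ∉ peanoGrid c r)
    (hg : g ∈ peanoGrid c r) (hg' : g' ∈ peanoGrid c r) (hgv : g ∈ Set.Ico v (v + c))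
    (hgv' : g' ∈ Set.Ioc (v - c) v) : g - g' = c := by
  have hgne : g ≠ v := fun h => hv (h ▸ hg)
  have hlt : v < g := lt_of_le_of_ne hgv.1 hgne.symm
  have := eq_of_mem_peanoGrid_of_abs_sub_lt (sub_mem_peanoGrid hg) hg' (by
    rw [abs_lt]
    constructor <;> linarith [hgv.2, hgv'.1, hgv'.2])
  linarith

namespace IsPeanoX

variable {x : ℝ → ℝ} {c r : ℝ} {w : List ℝ}

lemma exists_apply_eq (hx : IsPeanoX x) {t v : ℝ} (ht : t ∈ Set.Icc (0 : ℝ) 1) (hv0 : 0 ≤ v)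
    (hvt : v ≤ x t) : ∃ t' ∈ Set.Icc 0 t, x t' = v := by
  refine intermediate_value_Icc ht.1 (hx.continuousOn.mono (Set.Icc_subset_Icc_right ht.2)) ?_
  rw [hx.map_zero]
  exact ⟨hv0, hvt⟩

lemma head_visits (hx : IsPeanoX x) (hc0 : 0 < c) (hc1 : c ≤ 1)
    (hw : Visits x (peanoGrid c r) 0 1 w) :
    ∃ g ∈ peanoGrid c r, w.head? = some g ∧ g ∈ Set.Ico 0 c := by
  cases w with
  | nil =>
    obtain ⟨g, hg, hg0, hgc⟩ := exists_mem_peanoGrid_Ico hc0 r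
    obtain ⟨t, ht, htg⟩ := hx.exists_apply_eq (t := 1) (by simp) hg0
      (by rw [hx.map_one]; linarith)
    exact absurd (htg ▸ hg) (hw.notMem_of_nil rfl t ht)
  | cons g l =>
    obtain ⟨τ, hτ, hτg, hg, hfirst⟩ := hw.exists_first rfl
    refine ⟨g, hg, rfl, hτg ▸ (hx.mem_Icc hτ).1, ?_⟩
    by_contra! hcg
    obtain ⟨t, ht, htg⟩ := hx.exists_apply_eq hτ (v := g - c) (by linarith) (by linarith)
    have := hfirst t ht (htg ▸ sub_mem_peanoGrid hg)
    linarith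

lemma getLast_visits (hx : IsPeanoX x) (hc0 : 0 < c) (hc1 : c ≤ 1)
    (hw : Visits x (peanoGrid c r) 0 1 w) :
    ∃ g ∈ peanoGrid c r, w.getLast? = some g ∧ g ∈ Set.Ioc (1 - c) 1 := by
  have hG : ∀ v, 1 - v ∈ peanoGrid c (1 - r) ↔ v ∈ peanoGrid c r := by
    intro v
    constructor
    · rintro ⟨q, hq⟩
      exact ⟨-q, by push_cast; linarith⟩
    · rintro ⟨q, hq⟩
      exact ⟨-q, by push_cast; linarith⟩
  have hrev := hw.comp_neg.comp_affine (f' := x) (h := fun v => 1 - v) 1 one_pos hG (by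
    intro t ht
    rw [← hx.one_sub ⟨by linarith [ht.2], by linarith [ht.1]⟩]
    congr 1
    ring)
  norm_num at hrev
  obtain ⟨g, hg, hhead, hg0, hgc⟩ := hx.head_visits hc0 hc1 hrev
  rw [← List.map_reverse, List.head?_map, List.head?_reverse, Option.map_eq_some_iff] at hhead
  obtain ⟨g', hg', rfl⟩ := hhead
  exact ⟨g', (hG g').1 hg, hg', by linarith, by linarith⟩

/-- The part of the trajectory in one third of the unit interval consists of a scaled copy of the
whole trajectory, its time reversal and another copy. -/
lemma exists_visits_third (hx : IsPeanoX x) (hc0 : 0 < c) (hc1 : c ≤ 1 / 3) (r : ℝ) (a : Fin 3) :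
    ∃ w, Visits x (peanoGrid c r) ((a : ℕ) / 3) (((a : ℕ) + 1) / 3) w ∧
      sqIncr none w = 1 / 3 * qvar0 x (3 * c) (3 * r - (a : ℕ)) 1 ∧
      (∃ g ∈ peanoGrid c r, w.head? = some g ∧ g ∈ Set.Ico ((a : ℕ) / 3 : ℝ) ((a : ℕ) / 3 + c)) ∧
      ∃ g ∈ peanoGrid c r, w.getLast? = some g ∧
        g ∈ Set.Ioc (((a : ℕ) + 1) / 3 - c : ℝ) (((a : ℕ) + 1) / 3) := by
  obtain ⟨w, hw⟩ := Visits.exists_of_continuousOn hx.continuousOn (c := 3 * c) (by linarith)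
    (3 * r - (a : ℕ))
  obtain ⟨g, hg, hwg, hg0, hgc⟩ := hx.head_visits (by linarith) (by linarith) hw
  obtain ⟨g', hg', hwg', hg'c, hg'1⟩ := hx.getLast_visits (by linarith) (by linarith) hw
  let h : ℝ → ℝ := fun v => 1 / 3 * v + (a : ℕ) / 3
  have hG : ∀ v, h v ∈ peanoGrid c r ↔ v ∈ peanoGrid (3 * c) (3 * r - (a : ℕ)) := by
    intro v
    refine exists_congr fun q => ?_
    simp only [h]
    constructor <;> intro h <;> linarith
  have up : ∀ b : Fin 3, b ≠ 1 → Visits x (peanoGrid c r) (1 / 9 * 0 + (3 * (a : ℕ) + (b : ℕ)) / 9)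
      (1 / 9 * 1 + (3 * (a : ℕ) + (b : ℕ)) / 9) (w.map h) := by
    intro b hb
    refine hw.comp_affine _ (by norm_num) hG fun t ht => ?_
    have := hx.self_similar a b ht
    rw [if_neg hb] at this
    rw [show 1 / 9 * t + (3 * (a : ℕ) + (b : ℕ)) / 9 = (3 * (a : ℕ) + (b : ℕ) + t) / 9 by ring,
      this]
    simp only [h]
    ring
  have down : Visits x (peanoGrid c r) (1 / 9 * (-1) + (3 * (a : ℕ) + 2) / 9)
      (1 / 9 * (-0) + (3 * (a : ℕ) + 2) / 9) (w.reverse.map h) := by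
    refine hw.comp_neg.comp_affine _ (by norm_num) hG fun t ht => ?_
    have := hx.self_similar a 1 (s := 1 + t) ⟨by linarith [ht.1], by linarith [ht.2]⟩
    rw [if_pos rfl, ← hx.one_sub ⟨by linarith [ht.1], by linarith [ht.2]⟩,
      show 1 - (1 + t) = -t by ring] at this
    rw [show 1 / 9 * t + (3 * (a : ℕ) + 2) / 9 = (3 * (a : ℕ) + ((1 : Fin 3) : ℕ) + (1 + t)) / 9 by
      simp; ring, this]
    simp only [h]
    ring
  have hup₀ := up 0 (by decide)
  have hup₂ := up 2 (by decide)
  rw [show (1 / 9 * 1 + (3 * (a : ℕ) + ((0 : Fin 3) : ℕ)) / 9 : ℝ) =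
    1 / 9 * (-1) + (3 * (a : ℕ) + 2) / 9 by simp; ring,
    show (1 / 9 * 0 + (3 * (a : ℕ) + ((0 : Fin 3) : ℕ)) / 9 : ℝ) = (a : ℕ) / 3 by
      simp; ring] at hup₀
  rw [show (1 / 9 * 0 + (3 * (a : ℕ) + ((2 : Fin 3) : ℕ)) / 9 : ℝ) =
    1 / 9 * (-0) + (3 * (a : ℕ) + 2) / 9 by simp,
    show (1 / 9 * 1 + (3 * (a : ℕ) + ((2 : Fin 3) : ℕ)) / 9 : ℝ) = ((a : ℕ) + 1) / 3 by
      simp; ring] at hup₂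
  have hhead : (w.map h).head? = some (h g) := by simp [hwg]
  have hlast : (w.map h).getLast? = some (h g') := by simp [hwg']
  have hscale : sqIncr none (w.map h) = (1 / 3) ^ 2 * sqIncr none w :=
    sqIncr_map_affine (1 / 3) ((a : ℕ) / 3) none w
  refine ⟨w.map h ++ (w.reverse.map h ++ w.map h), hup₀.append (down.append hup₂), ?_,
    ⟨h g, (hG g).2 hg, ?_, ?_, ?_⟩, ⟨h g', (hG g').2 hg', ?_, ?_, ?_⟩⟩
  · rw [sqIncr_append_of_head_last hlast (g := h g') (by simp [hwg']),
      sqIncr_append_of_head_last (h := h g) (by simp [hwg]) hhead, List.map_reverse,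
      sqIncr_none_reverse, hscale, hw.qvar0_eq]
    ring
  · rw [List.head?_append, hhead, Option.some_or]
  · simp only [h]
    linarith
  · simp only [h]
    linarith
  · rw [List.getLast?_append, List.getLast?_append, hlast, Option.some_or, Option.some_or]
  · simp only [h]
    linarith
  · simp only [h]
    linarith

/-- The one-step recursion when neither `1/3` nor `2/3` lies in the grid. -/
lemma qvar0_eq_sum_thirds (hx : IsPeanoX x) (hc0 : 0 < c) (hc1 : c ≤ 1 / 3)
    (h₁ : 1 / 3 ∉ peanoGrid c r) (h₂ : 2 / 3 ∉ peanoGrid c r) :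
    qvar0 x c r 1 = 1 / 3 * ∑ a : Fin 3, qvar0 x (3 * c) (3 * r - (a : ℕ)) 1 + 2 * c ^ 2 := by
  obtain ⟨w₀, hw₀, hs₀, -, l₀, hl₀, hwl₀, hl₀m⟩ := hx.exists_visits_third hc0 hc1 r 0
  obtain ⟨w₁, hw₁, hs₁, ⟨g₁, hg₁, hwg₁, hg₁m⟩, l₁, hl₁, hwl₁, hl₁m⟩ :=
    hx.exists_visits_third hc0 hc1 r 1
  obtain ⟨w₂, hw₂, hs₂, ⟨g₂, hg₂, hwg₂, hg₂m⟩, -⟩ := hx.exists_visits_third hc0 hc1 r 2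
  norm_num at hw₀ hw₁ hw₂ hl₀m hg₁m hl₁m hg₂m
  have hd₁ : g₁ - l₀ = c := sub_eq_of_notMem_peanoGrid h₁ hg₁ hl₀
    ⟨hg₁m.1, hg₁m.2⟩ ⟨by linarith [hl₀m.1], hl₀m.2⟩
  have hd₂ : g₂ - l₁ = c := sub_eq_of_notMem_peanoGrid h₂ hg₂ hl₁
    ⟨hg₂m.1, hg₂m.2⟩ ⟨by linarith [hl₁m.1], hl₁m.2⟩
  rw [(hw₀.append (hw₁.append hw₂)).qvar0_eq,
    sqIncr_append_of_head_last hwl₀ (g := g₁) (by rw [List.head?_append, hwg₁, Option.some_or]),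
    sqIncr_append_of_head_last hwl₁ hwg₂, hd₁, hd₂, hs₀, hs₁, hs₂, Fin.sum_univ_three]
  ring

lemma qvar0_congr (hx : IsPeanoX x) (hc0 : 0 < c) {r' : ℝ} (h : peanoGrid c r = peanoGrid c r') :
    qvar0 x c r 1 = qvar0 x c r' 1 := by
  obtain ⟨w, hw⟩ := Visits.exists_of_continuousOn hx.continuousOn hc0 r
  rw [hw.qvar0_eq, (h ▸ hw : Visits x (peanoGrid c r') 0 1 w).qvar0_eq]

lemma qvar0_fract (hx : IsPeanoX x) (hc0 : 0 < c) (θ : ℝ) :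
    qvar0 x c (Int.fract θ * c) 1 = qvar0 x c (θ * c) 1 := by
  refine hx.qvar0_congr hc0 (Set.ext fun u => ⟨?_, ?_⟩)
  · rintro ⟨q, rfl⟩
    refine ⟨q - ⌊θ⌋, ?_⟩
    rw [Int.fract]
    push_cast
    ring
  · rintro ⟨q, rfl⟩
    refine ⟨q + ⌊θ⌋, ?_⟩
    rw [Int.fract]
    push_cast
    ring

/-- The recursion over `k` ternary levels when no subdivision point meets the grid. -/
lemma qvar0_eq_sum_iterate (hx : IsPeanoX x) (k : ℕ) {c θ : ℝ} (hc0 : 0 < c)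
    (hc1 : 3 ^ k * c ≤ 1)
    (hθ : ∀ m < k, ∀ (j : Fin m → Fin 3) (jm : Fin 2), ∀ z : ℤ,
      θ - (∑ l : Fin m, (j l : ℝ) * (1 / (3 ^ ((l : ℕ) + 1) * c)) +
        ((jm : ℕ) + 1 : ℝ) * (1 / (3 ^ (m + 1) * c))) ≠ z) :
    qvar0 x c (θ * c) 1 = 1 / 3 ^ k * ∑ i : Fin k → Fin 3, qvar0 x (3 ^ k * c)
        (Int.fract (θ - ∑ v : Fin k, (i v : ℝ) * (1 / (3 ^ ((v : ℕ) + 1) * c))) * (3 ^ k * c)) 1 +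
      (9 ^ k - 1) / 4 * c ^ 2 := by
  induction k generalizing c θ with
  | zero => simp [hx.qvar0_fract hc0]
  | succ k ih =>
    have hc3 : c ≤ 1 / 3 := by
      have : (1 : ℝ) ≤ 3 ^ k := one_le_pow₀ (by norm_num)
      have := mul_le_mul_of_nonneg_right this hc0.le
      rw [pow_succ] at hc1
      linarith
    have hnot : ∀ jm : Fin 2, ((jm : ℕ) + 1 : ℝ) / 3 ∉ peanoGrid c (θ * c) := by
      rintro jm ⟨q, hq⟩
      refine hθ 0 (Nat.succ_pos k) (fun _ => 0) jm (-q) ?_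
      simp only [Finset.univ_eq_empty, Finset.sum_empty]
      rw [show ((jm : ℕ) + 1 : ℝ) = 3 * (c * q + θ * c) by linarith]
      push_cast
      field_simp
      ring
    have hstep : ∀ a : Fin 3, qvar0 x (3 * c) (3 * (θ * c) - (a : ℕ)) 1 =
        1 / 3 ^ k * ∑ i : Fin k → Fin 3, qvar0 x (3 ^ (k + 1) * c)
          (Int.fract (θ - ∑ v : Fin (k + 1), ((Fin.cons a i : Fin (k + 1) → Fin 3) v : ℝ) *
            (1 / (3 ^ ((v : ℕ) + 1) * c))) * (3 ^ (k + 1) * c)) 1 +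
        (9 ^ k - 1) / 4 * (3 * c) ^ 2 := by
      intro a
      have hpow : ∀ m : ℕ, (3 : ℝ) ^ m * (3 * c) = 3 ^ (m + 1) * c := fun m => by ring
      have hoff : 3 * (θ * c) - (a : ℕ) = (θ - (a : ℕ) * (1 / (3 * c))) * (3 * c) := by
        field_simp
      rw [hoff, ih (by linarith) (by rw [hpow]; exact hc1)]
      · simp only [hpow, Fin.sum_univ_succ, Fin.cons_zero, Fin.cons_succ, Fin.val_zero, zero_add,
          pow_one, Fin.val_succ, sub_sub]
      · intro m hm j jm z
        have := hθ (m + 1) (by omega) (Fin.cons a j) jm z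
        simpa only [hpow, Fin.sum_univ_succ, Fin.cons_zero, Fin.cons_succ, Fin.val_zero, zero_add,
          pow_one, Fin.val_succ, sub_sub, add_assoc] using this
    rw [hx.qvar0_eq_sum_thirds hc0 hc3 (by simpa using hnot 0)
      (by convert hnot 1 using 1; norm_num), Finset.sum_congr rfl fun a _ => hstep a,
      ← (Fin.consEquiv fun _ : Fin (k + 1) => Fin 3).sum_comp, Fintype.sum_prod_type]
    simp only [Fin.consEquiv, Equiv.coe_fn_mk, Finset.sum_add_distrib, Finset.sum_const,
      Finset.card_univ, Fintype.card_fin, nsmul_eq_mul, ← Finset.mul_sum]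
    push_cast
    ring

end IsPeanoX

/-- When no number `θ - Σ_{l=1}^m j_l 3^n q'/(3^l p')` is an integer (e.g. when `θ` is
irrational), the indicator part of the `k`-step recursion equals
`(1/4)(9^k - 1)/9^n (p'/q')²`, and the `k`-step recursion simplifies accordingly. -/
theorem peano_k_step_recursion_irrational (x : ℝ → ℝ) (hx : IsPeanoX x)
    (p' q' : ℕ) (hp'pos : 0 < p') (hq'pos : 0 < q')
    (hp'3 : ¬ (3 ∣ p')) (hq'3 : ¬ (3 ∣ q'))
    (θ : ℝ) (hθ : θ ∈ Set.Ico (0 : ℝ) 1)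
    (n : ℤ) (k : ℕ) (hk : 0 < k)
    (hkn : ((p' : ℝ) / (q' : ℝ)) / (3 : ℝ) ^ (n - (k : ℤ) + 1) ≤ 1 / 3)
    (hnint : ∀ m : ℕ, 1 ≤ m → m ≤ k → ∀ (j : Fin (m - 1) → Fin 3) (jm : Fin 2), ∀ z : ℤ,
      θ - (∑ l : Fin (m - 1),
            (j l : ℝ) * ((3 : ℝ) ^ n * (q' : ℝ) / ((3 : ℝ) ^ ((l : ℕ) + 1) * (p' : ℝ))) +
          ((jm : ℕ) + 1 : ℝ) * ((3 : ℝ) ^ n * (q' : ℝ) / ((3 : ℝ) ^ m * (p' : ℝ)))) ≠ (z : ℝ)) :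
    (∑ m ∈ Finset.Icc 1 k, (1 / (3 : ℝ) ^ (m - 1)) *
        ∑ j : Fin (m - 1) → Fin 3, ∑ jm : Fin 2,
          (if Int.fract (θ - (∑ l : Fin (m - 1),
                (j l : ℝ) * ((3 : ℝ) ^ n * (q' : ℝ) / ((3 : ℝ) ^ ((l : ℕ) + 1) * (p' : ℝ))) +
                ((jm : ℕ) + 1 : ℝ) * ((3 : ℝ) ^ n * (q' : ℝ) / ((3 : ℝ) ^ m * (p' : ℝ)))))
              ∈ Set.Ioo (0 : ℝ) 1 then (1 : ℝ) else 0) *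
            (((3 : ℝ) ^ (m - 1) * (p' : ℝ)) / ((3 : ℝ) ^ n * (q' : ℝ))) ^ 2)
      = 1 / 4 * (((9 : ℝ) ^ k - 1) / (9 : ℝ) ^ n) * ((p' : ℝ) / (q' : ℝ)) ^ 2 ∧
    qvar0 x (((p' : ℝ) / (q' : ℝ)) / (3 : ℝ) ^ n) (θ * ((p' : ℝ) / (q' : ℝ)) / (3 : ℝ) ^ n) 1 =
      (1 / (3 : ℝ) ^ k) * ∑ i : Fin k → Fin 3,
        qvar0 x (((3 : ℝ) ^ k * (p' : ℝ)) / ((3 : ℝ) ^ n * (q' : ℝ)))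
          (Int.fract (θ - ∑ v : Fin k,
              (i v : ℝ) * ((3 : ℝ) ^ n * (q' : ℝ) / ((3 : ℝ) ^ ((v : ℕ) + 1) * (p' : ℝ)))) *
            (((3 : ℝ) ^ k * (p' : ℝ)) / ((3 : ℝ) ^ n * (q' : ℝ)))) 1 +
      1 / 4 * (((9 : ℝ) ^ k - 1) / (9 : ℝ) ^ n) * ((p' : ℝ) / (q' : ℝ)) ^ 2 := by
  have h3n : (3 : ℝ) ^ n ≠ 0 := by positivity
  have hp : (p' : ℝ) ≠ 0 := by exact_mod_cast hp'pos.ne'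
  have hq : (q' : ℝ) ≠ 0 := by exact_mod_cast hq'pos.ne'
  have h9 : (9 : ℝ) ^ n = (3 ^ n) ^ 2 := by
    rw [show (9 : ℝ) = 3 * 3 by norm_num, mul_zpow, sq]
  constructor
  · have hterm : ∀ m ∈ Finset.Icc 1 k, (1 / (3 : ℝ) ^ (m - 1)) *
        ∑ j : Fin (m - 1) → Fin 3, ∑ jm : Fin 2,
          (if Int.fract (θ - (∑ l : Fin (m - 1),
                (j l : ℝ) * ((3 : ℝ) ^ n * (q' : ℝ) / ((3 : ℝ) ^ ((l : ℕ) + 1) * (p' : ℝ))) +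
                ((jm : ℕ) + 1 : ℝ) * ((3 : ℝ) ^ n * (q' : ℝ) / ((3 : ℝ) ^ m * (p' : ℝ)))))
              ∈ Set.Ioo (0 : ℝ) 1 then (1 : ℝ) else 0) *
            (((3 : ℝ) ^ (m - 1) * (p' : ℝ)) / ((3 : ℝ) ^ n * (q' : ℝ))) ^ 2 =
        9 ^ (m - 1) * (2 * (p' / (3 ^ n * q')) ^ 2) := by
      intro m hm
      rw [Finset.mem_Icc] at hm
      have hone : ∀ (j : Fin (m - 1) → Fin 3) (jm : Fin 2),
          Int.fract (θ - (∑ l : Fin (m - 1),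
            (j l : ℝ) * ((3 : ℝ) ^ n * (q' : ℝ) / ((3 : ℝ) ^ ((l : ℕ) + 1) * (p' : ℝ))) +
            ((jm : ℕ) + 1 : ℝ) * ((3 : ℝ) ^ n * (q' : ℝ) / ((3 : ℝ) ^ m * (p' : ℝ)))))
            ∈ Set.Ioo (0 : ℝ) 1 := by
        refine fun j jm => ⟨(Int.fract_nonneg _).lt_of_ne fun h => ?_, Int.fract_lt_one _⟩
        obtain ⟨z, hz⟩ := Int.fract_eq_zero_iff.1 h.symm
        exact hnint m hm.1 hm.2 j jm z hz.symm
      simp only [if_pos (hone _ _), one_mul, Finset.sum_const, Finset.card_univ, Fintype.card_fin,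
        Fintype.card_pi, Finset.prod_const, nsmul_eq_mul]
      push_cast
      rw [show (9 : ℝ) = 3 * 3 by norm_num, mul_pow]
      field_simp
    rw [Finset.sum_congr rfl hterm, ← Finset.sum_mul,
      ← Finset.Ico_add_one_right_eq_Icc, Finset.sum_Ico_eq_sum_range]
    simp only [Nat.add_sub_cancel, Nat.add_sub_cancel_left]
    rw [geom_sum_eq (by norm_num), h9]
    field_simp
    ring
  · have hc0 : (0 : ℝ) < p' / q' / 3 ^ n := by positivity
    have hc1 : 3 ^ k * ((p' : ℝ) / q' / 3 ^ n) ≤ 1 := by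
      have hpow : (3 : ℝ) ^ (n - (k : ℤ) + 1) = 3 ^ n / 3 ^ k * 3 := by
        rw [zpow_add₀ (by norm_num), zpow_sub₀ (by norm_num), zpow_natCast, zpow_one]
      rw [hpow] at hkn
      have : 3 ^ k * ((p' : ℝ) / q' / 3 ^ n) = 3 * (p' / q' / (3 ^ n / 3 ^ k * 3)) := by
        field_simp
      linarith
    have hinv : ∀ m : ℕ, 1 / ((3 : ℝ) ^ m * (p' / q' / 3 ^ n)) = 3 ^ n * q' / (3 ^ m * p') := by
      intro m
      field_simp
    have hmesh : (3 : ℝ) ^ k * (p' / q' / 3 ^ n) = 3 ^ k * p' / (3 ^ n * q') := by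
      field_simp
    have key := hx.qvar0_eq_sum_iterate k (θ := θ) hc0 hc1 fun m hm j jm z => by
      simp only [hinv]
      exact hnint (m + 1) (by omega) hm j jm z
    simp only [hinv, hmesh] at key
    rw [mul_div_assoc, key, h9]
    congr 1
    field_simp
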